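/- arXiv:1611.04656 — 2 statements merged into one kernel-verified Lean document; each statement's English description precedes it below -/
import Mathlib

section
/- Let k ≥ 1 be an integer, let p and γ be real numbers with p > 1 and γ < k, and let ψ : ℝᵏ → ℝ be a nonnegative compactly supported C¹ function. If equality holds in the Hardy inequality, i.e. ((k−γ)/p)^p · ∫_{ℝᵏ} ψ(x)^p ‖x‖^{−γ} dx = ∫_{ℝᵏ} ‖∇ψ(x)‖^p ‖x‖^{p−γ} dx, then ψ ≡ 0 on ℝᵏ. -/
open MeasureTheory Metric Real

section HardyEquality

variable {E : Type*} [NormedAddCommGroup E] [NormedSpace ℝ E] [FiniteDimensional ℝ E]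
  [MeasurableSpace E] [BorelSpace E] {μ : Measure E} [μ.IsAddHaarMeasure]

lemma locallyIntegrable_norm_rpow_neg (hd : 1 ≤ Module.finrank ℝ E) {γ : ℝ}
    (hγ : γ < Module.finrank ℝ E) : LocallyIntegrable (fun x : E ↦ ‖x‖ ^ (-γ)) μ := by
  refine locallyIntegrable_of_norm_le_rpow (C := 1) hd hγ (.of_forall fun x ↦ ?_) ?_
  · rw [Real.norm_of_nonneg (by positivity), one_mul]
  · exact (measurable_norm.pow_const _).aestronglyMeasurable

lemma integrable_mul_norm_rpow_neg (hd : 1 ≤ Module.finrank ℝ E) {γ : ℝ}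
    (hγ : γ < Module.finrank ℝ E) {g : E → ℝ} (hg : Continuous g) (hgs : HasCompactSupport g) :
    Integrable (fun x ↦ g x * ‖x‖ ^ (-γ)) μ :=
  (locallyIntegrable_norm_rpow_neg hd hγ).integrable_smul_left_of_hasCompactSupport hg hgs

/-- Integration by parts of the radial derivative against the weight `‖x‖ ^ (-γ)`, obtained by
differentiating the scaling identity for `∫ f (t • x) * ‖x‖ ^ (-γ)` at `t = 1`. -/
theorem integral_fderiv_apply_self_mul_norm_rpow_neg (hd : 1 ≤ Module.finrank ℝ E) {γ : ℝ}
    (hγ : γ < Module.finrank ℝ E) {f : E → ℝ} (hf : ContDiff ℝ 1 f) (hfs : HasCompactSupport f) :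
    ∫ x, fderiv ℝ f x x * ‖x‖ ^ (-γ) ∂μ
      = (γ - Module.finrank ℝ E) * ∫ x, f x * ‖x‖ ^ (-γ) ∂μ := by
  have hf' : Continuous (fderiv ℝ f) := hf.continuous_fderiv one_ne_zero
  obtain ⟨C, hC⟩ := hf'.bounded_above_of_compact_support (hfs.fderiv (𝕜 := ℝ))
  have hC0 : 0 ≤ C := (norm_nonneg _).trans (hC 0)
  obtain ⟨R, hR0, hR⟩ := hfs.fderiv (𝕜 := ℝ) |>.isCompact.isBounded.exists_pos_norm_lt
  have hderiv : HasDerivAt (fun t : ℝ ↦ ∫ x, f (t • x) * ‖x‖ ^ (-γ) ∂μ)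
      (∫ x, fderiv ℝ f ((1 : ℝ) • x) x * ‖x‖ ^ (-γ) ∂μ) 1 := by
    refine (hasDerivAt_integral_of_dominated_loc_of_deriv_le (s := Set.Ioi (1 / 2 : ℝ))
      (F' := fun t x ↦ fderiv ℝ f (t • x) x * ‖x‖ ^ (-γ))
      (bound := (ball (0 : E) (2 * R)).indicator fun x ↦ C * (2 * R) * ‖x‖ ^ (-γ))
      (Ioi_mem_nhds (by norm_num)) (.of_forall fun t ↦ ?_) ?_ ?_
      (.of_forall fun x t ht ↦ ?_) ?_ (.of_forall fun x t _ ↦ ?_)).2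
    · exact (hf.continuous.comp (continuous_const_smul t)).aestronglyMeasurable.mul
        (measurable_norm.pow_const _).aestronglyMeasurable
    · simpa using integrable_mul_norm_rpow_neg hd hγ hf.continuous hfs
    · simp only [one_smul]
      exact (hf'.clm_apply continuous_id).aestronglyMeasurable.mul
        (measurable_norm.pow_const _).aestronglyMeasurable
    · have ht' : (1 / 2 : ℝ) < t := ht
      have hw : 0 ≤ ‖x‖ ^ (-γ) := by positivity
      by_cases hx : x ∈ ball (0 : E) (2 * R)
      · rw [Set.indicator_of_mem hx, norm_mul, Real.norm_of_nonneg hw]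
        rw [mem_ball_zero_iff] at hx
        gcongr
        exact ((fderiv ℝ f (t • x)).le_opNorm x).trans (by gcongr; exact hC _)
      · have hzero : fderiv ℝ f (t • x) = 0 := by
          by_contra hne
          have hlt := hR _ (subset_tsupport _ hne)
          rw [norm_smul, Real.norm_of_nonneg (by linarith)] at hlt
          rw [mem_ball_zero_iff, not_lt] at hx
          nlinarith [norm_nonneg x]
        simp [hzero, Set.indicator_of_notMem hx]
    · rw [integrable_indicator_iff measurableSet_ball]
      exact ((locallyIntegrable_norm_rpow_neg hd hγ).integrableOn_isCompact
        (isCompact_closedBall 0 (2 * R)) |>.mono_set ball_subset_closedBall).const_mul _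
    · have h1 : HasDerivAt (fun t : ℝ ↦ t • x) x t := by
        simpa using (hasDerivAt_id t).smul_const x
      exact ((hf.differentiable one_ne_zero _).hasFDerivAt.comp_hasDerivAt t h1).mul_const _
  have hscale : (fun t : ℝ ↦ ∫ x, f (t • x) * ‖x‖ ^ (-γ) ∂μ) =ᶠ[nhds 1]
      fun t ↦ t ^ (γ - Module.finrank ℝ E) * ∫ x, f x * ‖x‖ ^ (-γ) ∂μ := by
    filter_upwards [Ioi_mem_nhds (zero_lt_one' ℝ)] with t (ht : 0 < t)
    have h := Measure.integral_comp_smul μ (fun x ↦ f x * ‖x‖ ^ (-γ)) t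
    have hpull : ∀ x : E, f (t • x) * ‖t • x‖ ^ (-γ)
        = t ^ (-γ) * (f (t • x) * ‖x‖ ^ (-γ)) := fun x ↦ by
      rw [norm_smul, Real.norm_of_nonneg ht.le, Real.mul_rpow ht.le (norm_nonneg _)]
      ring
    simp only [hpull, integral_const_mul] at h
    rw [abs_of_pos (by positivity), smul_eq_mul] at h
    rw [Real.rpow_sub ht, Real.rpow_natCast]
    rw [Real.rpow_neg ht.le] at h
    have : 0 < t ^ γ := by positivity
    field_simp at h ⊢
    linarith
  have hpow : HasDerivAt (fun t : ℝ ↦ t ^ (γ - Module.finrank ℝ E) * ∫ x, f x * ‖x‖ ^ (-γ) ∂μ)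
      ((γ - Module.finrank ℝ E) * ∫ x, f x * ‖x‖ ^ (-γ) ∂μ) 1 := by
    simpa using (Real.hasDerivAt_rpow_const (x := 1) (p := γ - Module.finrank ℝ E)
      (Or.inl one_ne_zero)).mul_const (∫ x, f x * ‖x‖ ^ (-γ) ∂μ)
  simpa using hderiv.unique (hpow.congr_of_eventuallyEq hscale)

/-- Strict tangent line inequality for `b ↦ b ^ p` at `a`. -/
lemma mul_rpow_sub_one_mul_lt {p a b : ℝ} (hp : 1 < p) (ha : 0 ≤ a) (hb : 0 ≤ b) (hab : b ≠ a) :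
    p * a ^ (p - 1) * b < b ^ p + (p - 1) * a ^ p := by
  rcases ha.eq_or_lt with rfl | ha
  · have : 0 < b ^ p := Real.rpow_pos_of_pos (hb.lt_of_ne' hab) p
    simpa [Real.zero_rpow (by linarith : p - 1 ≠ 0), Real.zero_rpow (by linarith : p ≠ 0)]
  · have hne : b / a - 1 ≠ 0 := by
      rw [sub_ne_zero]
      exact fun h ↦ hab ((div_eq_one_iff_eq ha.ne').1 h)
    have h := one_add_mul_self_lt_rpow_one_add
      (by linarith [div_nonneg hb ha.le] : -1 ≤ b / a - 1) hne hp
    rw [add_sub_cancel, Real.div_rpow hb ha.le, lt_div_iff₀ (by positivity)] at h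
    have hmul : a ^ p = a ^ (p - 1) * a := by
      rw [← Real.rpow_add_one ha.ne', sub_add_cancel]
    have hexp : (1 + p * (b / a - 1)) * a ^ p = p * a ^ (p - 1) * b - (p - 1) * a ^ p := by
      rw [hmul]
      field_simp
      ring
    linarith

lemma mul_rpow_sub_one_mul_le {p a b : ℝ} (hp : 1 < p) (ha : 0 ≤ a) (hb : 0 ≤ b) :
    p * a ^ (p - 1) * b ≤ b ^ p + (p - 1) * a ^ p := by
  rcases eq_or_ne b a with rfl | hab
  · rcases hb.eq_or_lt with rfl | hb
    · simp [Real.zero_rpow (by linarith : p ≠ 0)]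
    · rw [mul_assoc, ← Real.rpow_add_one hb.ne', sub_add_cancel]
      linarith
  · exact (mul_rpow_sub_one_mul_lt hp ha hb hab).le

lemma eq_of_rpow_add_eq_mul {p a b c : ℝ} (hp : 1 < p) (ha : 0 ≤ a) (hcb : |c| ≤ b)
    (h : b ^ p + (p - 1) * a ^ p - p * a ^ (p - 1) * c = 0) : c = a := by
  have hb : 0 ≤ b := (abs_nonneg c).trans hcb
  have hcb' : c ≤ b := (le_abs_self c).trans hcb
  have hle : p * a ^ (p - 1) * c ≤ p * a ^ (p - 1) * b := by gcongr
  have hba : b = a := by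
    by_contra hne
    linarith [mul_rpow_sub_one_mul_lt hp ha hb hne]
  subst hba
  rcases ha.eq_or_lt with rfl | ha
  · exact abs_nonpos_iff.1 hcb
  · rw [show b ^ p = b ^ (p - 1) * b by rw [← Real.rpow_add_one ha.ne', sub_add_cancel]] at h
    have hpos : 0 < p * b ^ (p - 1) := by positivity
    have : p * b ^ (p - 1) * (b - c) = 0 := by linarith
    linarith [(mul_eq_zero.1 this).resolve_left hpos.ne']

/-- A compactly supported function homogeneous of nonzero degree `-c`, in the sense of Euler's
relation, vanishes. -/
lemma eq_zero_of_neg_fderiv_apply_self_eq {F : Type*} [NormedAddCommGroup F] [NormedSpace ℝ F]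
    {ψ : F → ℝ} {c : ℝ} (hc : c ≠ 0) (hψ : Differentiable ℝ ψ)
    (hsupp : HasCompactSupport ψ) (h : ∀ x, -fderiv ℝ ψ x x = c * ψ x) (x : F) : ψ x = 0 := by
  rcases eq_or_ne x 0 with rfl | hx
  · simpa [hc] using (h 0).symm
  obtain ⟨R, hR0, hR⟩ := hsupp.isCompact.isBounded.exists_pos_norm_lt
  have hd : ∀ t ∈ Set.Ioi (0 : ℝ), HasDerivAt (fun t : ℝ ↦ t ^ c * ψ (t • x)) 0 t := by
    intro t (ht : 0 < t)
    have h1 : HasDerivAt (fun t : ℝ ↦ t • x) x t := by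
      simpa using (hasDerivAt_id t).smul_const x
    have h2 := (Real.hasDerivAt_rpow_const (p := c) (Or.inl ht.ne')).mul
      ((hψ (t • x)).hasFDerivAt.comp_hasDerivAt t h1)
    refine h2.congr_deriv ?_
    have h3 := h (t • x)
    rw [map_smul, smul_eq_mul] at h3
    have hmul : t ^ c = t ^ (c - 1) * t := by
      rw [← Real.rpow_add_one ht.ne', sub_add_cancel]
    simp only [Function.comp_apply]
    linear_combination (fderiv ℝ ψ (t • x) x) * hmul - t ^ (c - 1) * h3
  have hconst : ∀ t ∈ Set.Ioi (0 : ℝ), t ^ c * ψ (t • x) = (1 : ℝ) ^ c * ψ ((1 : ℝ) • x) :=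
    fun t ht ↦ isOpen_Ioi.is_const_of_deriv_eq_zero isPreconnected_Ioi
      (fun s hs ↦ (hd s hs).differentiableAt.differentiableWithinAt)
      (fun s hs ↦ (hd s hs).deriv) ht (Set.mem_Ioi.2 one_pos)
  have hxpos : 0 < ‖x‖ := norm_pos_iff.2 hx
  have hfar : ψ ((R / ‖x‖) • x) = 0 := by
    by_contra hne
    have hlt := hR _ (subset_tsupport _ hne)
    rw [norm_smul, Real.norm_of_nonneg (by positivity), div_mul_cancel₀ _ hxpos.ne'] at hlt
    exact lt_irrefl _ hlt
  simpa [hfar] using (hconst (R / ‖x‖) (Set.mem_Ioi.2 (by positivity))).symm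

/-- Rigidity in the Hardy inequality on a finite-dimensional normed space. -/
theorem eq_zero_of_hardy_equality (hdim : 1 ≤ Module.finrank ℝ E) {p γ : ℝ} (hp : 1 < p)
    (hγ : γ < Module.finrank ℝ E) {ψ : E → ℝ} (hψ : ContDiff ℝ 1 ψ)
    (hsupp : HasCompactSupport ψ) (hpos : ∀ x, 0 ≤ ψ x)
    (heq : ((Module.finrank ℝ E - γ) / p) ^ p * ∫ x, ψ x ^ p * ‖x‖ ^ (-γ) ∂μ
      = ∫ x, ‖fderiv ℝ ψ x‖ ^ p * ‖x‖ ^ (p - γ) ∂μ) (x : E) : ψ x = 0 := by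
  have : Nontrivial E := Module.nontrivial_of_finrank_pos (R := ℝ) (by omega)
  have hp0 : 0 < p := by linarith
  set c : ℝ := (Module.finrank ℝ E - γ) / p with hc_def
  have hc : 0 < c := div_pos (by linarith) hp0
  have hcp : p * c = Module.finrank ℝ E - γ := by rw [hc_def]; field_simp
  have hψ' : Continuous (fderiv ℝ ψ) := hψ.continuous_fderiv one_ne_zero
  have hne : ∀ᵐ x ∂μ, x ≠ 0 := by simp [ae_iff]
  have hint1 : Integrable (fun x ↦ ψ x ^ p * ‖x‖ ^ (-γ)) μ :=
    integrable_mul_norm_rpow_neg hdim hγ (hψ.continuous.rpow_const fun _ ↦ Or.inr hp0.le)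
      (hsupp.comp_left (g := fun y ↦ y ^ p) (Real.zero_rpow hp0.ne'))
  have hint2 : Integrable (fun x ↦ (‖x‖ * ‖fderiv ℝ ψ x‖) ^ p * ‖x‖ ^ (-γ)) μ := by
    refine integrable_mul_norm_rpow_neg hdim hγ
      ((continuous_norm.mul hψ'.norm).rpow_const fun _ ↦ Or.inr hp0.le) ?_
    exact (hsupp.fderiv (𝕜 := ℝ)).norm.mul_left.comp_left (g := fun y : ℝ ↦ y ^ p)
      (Real.zero_rpow hp0.ne')
  have hint3 : Integrable (fun x ↦ ψ x ^ (p - 1) * fderiv ℝ ψ x x * ‖x‖ ^ (-γ)) μ := by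
    refine integrable_mul_norm_rpow_neg hdim hγ
      ((hψ.continuous.rpow_const fun _ ↦ Or.inr (by linarith)).mul
        (hψ'.clm_apply continuous_id)) ?_
    exact HasCompactSupport.mul_right (hsupp.comp_left (g := fun y ↦ y ^ (p - 1))
      (Real.zero_rpow (by linarith)))
  have hgrad : ∫ x, ‖fderiv ℝ ψ x‖ ^ p * ‖x‖ ^ (p - γ) ∂μ
      = ∫ x, (‖x‖ * ‖fderiv ℝ ψ x‖) ^ p * ‖x‖ ^ (-γ) ∂μ := by
    refine integral_congr_ae ?_
    filter_upwards [hne] with x hx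
    rw [Real.mul_rpow (norm_nonneg _) (norm_nonneg _), sub_eq_add_neg,
      Real.rpow_add (norm_pos_iff.2 hx)]
    ring
  have hparts : p * ∫ x, ψ x ^ (p - 1) * fderiv ℝ ψ x x * ‖x‖ ^ (-γ) ∂μ
      = -(p * c) * ∫ x, ψ x ^ p * ‖x‖ ^ (-γ) ∂μ := by
    have h := integral_fderiv_apply_self_mul_norm_rpow_neg (μ := μ) hdim hγ
      (hψ.rpow_const_of_le (m := 1) (p := p) (by exact_mod_cast hp.le))
      (hsupp.comp_left (g := fun y ↦ y ^ p) (Real.zero_rpow hp0.ne'))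
    have hfd : ∀ x, fderiv ℝ (fun x ↦ ψ x ^ p) x x
        = p * (ψ x ^ (p - 1) * fderiv ℝ ψ x x) := fun x ↦ by
      rw [((hψ.differentiable one_ne_zero x).hasFDerivAt.rpow_const (Or.inr hp.le)).fderiv]
      simp [mul_assoc]
    simp only [hfd, mul_assoc p, integral_const_mul] at h
    rw [h, hcp]
    ring
  set D : E → ℝ := fun x ↦ (‖x‖ * ‖fderiv ℝ ψ x‖) ^ p + (p - 1) * (c * ψ x) ^ p
    - p * (c * ψ x) ^ (p - 1) * -fderiv ℝ ψ x x with hD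
  have hbound : ∀ x, |-fderiv ℝ ψ x x| ≤ ‖x‖ * ‖fderiv ℝ ψ x‖ := fun x ↦ by
    rw [abs_neg, mul_comm]
    exact (fderiv ℝ ψ x).le_opNorm x
  have hA : ∀ x, 0 ≤ c * ψ x := fun x ↦ mul_nonneg hc.le (hpos x)
  have hDnn : ∀ x, 0 ≤ D x := fun x ↦ by
    have h1 := mul_rpow_sub_one_mul_le hp (hA x) ((abs_nonneg _).trans (hbound x))
    have h2 : p * (c * ψ x) ^ (p - 1) * -fderiv ℝ ψ x x
        ≤ p * (c * ψ x) ^ (p - 1) * (‖x‖ * ‖fderiv ℝ ψ x‖) :=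
      mul_le_mul_of_nonneg_left ((le_abs_self _).trans (hbound x))
        (mul_nonneg hp0.le (Real.rpow_nonneg (hA x) _))
    simp only [hD]
    linarith
  have hDexp : (fun x ↦ D x * ‖x‖ ^ (-γ)) = fun x ↦
      (‖x‖ * ‖fderiv ℝ ψ x‖) ^ p * ‖x‖ ^ (-γ) + ((p - 1) * c ^ p) * (ψ x ^ p * ‖x‖ ^ (-γ))
        + (p * c ^ (p - 1)) * (ψ x ^ (p - 1) * fderiv ℝ ψ x x * ‖x‖ ^ (-γ)) := by
    ext x
    simp only [hD, Real.mul_rpow hc.le (hpos x)]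
    ring
  have hint12 : Integrable (fun x ↦ (‖x‖ * ‖fderiv ℝ ψ x‖) ^ p * ‖x‖ ^ (-γ)
      + ((p - 1) * c ^ p) * (ψ x ^ p * ‖x‖ ^ (-γ))) μ := hint2.add (hint1.const_mul _)
  have hDint : Integrable (fun x ↦ D x * ‖x‖ ^ (-γ)) μ := by
    rw [hDexp]
    exact hint12.add (hint3.const_mul _)
  have hD0 : ∫ x, D x * ‖x‖ ^ (-γ) ∂μ = 0 := by
    rw [hDexp, integral_add hint12 (hint3.const_mul _),
      integral_add hint2 (hint1.const_mul _), integral_const_mul, integral_const_mul,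
      ← hgrad, ← heq]
    have hmul : c ^ p = c ^ (p - 1) * c := by
      rw [← Real.rpow_add_one hc.ne', sub_add_cancel]
    linear_combination c ^ (p - 1) * hparts + p * (∫ x, ψ x ^ p * ‖x‖ ^ (-γ) ∂μ) * hmul
  have hDae : D =ᵐ[μ] fun _ ↦ 0 := by
    have h := (integral_eq_zero_iff_of_nonneg
      (fun x ↦ mul_nonneg (hDnn x) (Real.rpow_nonneg (norm_nonneg x) _)) hDint).1 hD0
    filter_upwards [h, hne] with x hx hx0
    exact (mul_eq_zero.1 hx).resolve_right (Real.rpow_pos_of_pos (norm_pos_iff.2 hx0) _).ne'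
  have hDcont : Continuous D := by
    have hAc : Continuous fun x ↦ c * ψ x := continuous_const.mul hψ.continuous
    exact (((continuous_norm.mul hψ'.norm).rpow_const fun _ ↦ Or.inr hp0.le).add
      (continuous_const.mul (hAc.rpow_const fun _ ↦ Or.inr hp0.le))).sub
      ((continuous_const.mul (hAc.rpow_const fun _ ↦ Or.inr (by linarith))).mul
        (hψ'.clm_apply continuous_id).neg)
  have hDzero : D = fun _ ↦ 0 := (hDcont.ae_eq_iff_eq μ continuous_const).1 hDae
  exact eq_zero_of_neg_fderiv_apply_self_eq hc.ne' (hψ.differentiable one_ne_zero) hsupp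
    (fun y ↦ eq_of_rpow_add_eq_mul hp (hA y) (hbound y) (congrFun hDzero y)) x

end HardyEquality

/-- Equality case of the flat Hardy inequality (Theorem `teo-hardy` of the paper with
`M = ℝᵏ` and `p > 1`): if equality holds, then `ψ ≡ 0`. -/
theorem hardy_flat_equality (k : ℕ) (hk : 1 ≤ k) (p γ : ℝ) (hp : 1 < p) (hγ : γ < (k : ℝ))
    (ψ : EuclideanSpace ℝ (Fin k) → ℝ) (hψ : ContDiff ℝ 1 ψ)
    (hsupp : HasCompactSupport ψ) (hpos : ∀ x, 0 ≤ ψ x)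
    (heq : (((k : ℝ) - γ) / p) ^ p * ∫ x : EuclideanSpace ℝ (Fin k), ψ x ^ p * ‖x‖ ^ (-γ)
      = ∫ x : EuclideanSpace ℝ (Fin k), ‖gradient ψ x‖ ^ p * ‖x‖ ^ (p - γ)) :
    ∀ x, ψ x = 0 := by
  have hgrad : ∀ x, ‖gradient ψ x‖ = ‖fderiv ℝ ψ x‖ := fun x ↦
    LinearIsometryEquiv.norm_map _ _
  simp only [hgrad] at heq
  exact eq_zero_of_hardy_equality (μ := volume) (by simpa using hk) hp (by simpa using hγ) hψ
    hsupp hpos (by simpa using heq)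
end

section
/- Let k be an integer and p > 1 a real number with k > 2p. Then for every nonnegative compactly supported C² function ψ : ℝᵏ → ℝ one has (k^p (k−2p)^p (p−1)^p / p^{2p}) · ∫_{ℝᵏ} ψ(x)^p ‖x‖^{−2p} dx ≤ ∫_{ℝᵏ} |Δψ(x)|^p dx. -/
open MeasureTheory Metric Real

/-- The Laplacian `Δψ(x) = Σᵢ ∂²ψ/∂xᵢ²(x)` of a function on Euclidean space, as the sum of
the second derivatives along the standard coordinate directions. -/
noncomputable def euclideanLaplacian {k : ℕ} (ψ : EuclideanSpace ℝ (Fin k) → ℝ)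
    (x : EuclideanSpace ℝ (Fin k)) : ℝ :=
  ∑ i : Fin k, iteratedDeriv 2 (fun t : ℝ => ψ (x + t • EuclideanSpace.single i 1)) 0


theorem integral_fderiv_apply_eq_zero {E : Type*} [NormedAddCommGroup E] [NormedSpace ℝ E]
    [FiniteDimensional ℝ E] [MeasurableSpace E] [BorelSpace E] (μ : Measure E)
    [μ.IsAddHaarMeasure] {f : E → ℝ} (hf : ContDiff ℝ 1 f) (hs : HasCompactSupport f) (v : E) :
    ∫ x, fderiv ℝ f x v ∂μ = 0 := by
  have hc : Continuous fun x => fderiv ℝ f x v :=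
    (hf.continuous_fderiv one_ne_zero).clm_apply continuous_const
  have h := integral_mul_fderiv_eq_neg_fderiv_mul_of_integrable (μ := μ) (f := fun _ : E => (1 : ℝ))
    (g := f) (v := v) (by simp)
    (by simpa using hc.integrable_of_hasCompactSupport (hs.fderiv_apply ℝ v))
    (by simpa using hf.continuous.integrable_of_hasCompactSupport hs)
    (by fun_prop) (fun x _ => hf.differentiable one_ne_zero x)
  simpa using h

theorem euclideanLaplacian_eq_sum_fderiv {k : ℕ} {ψ : EuclideanSpace ℝ (Fin k) → ℝ}
    (hψ : ContDiff ℝ 2 ψ) (x : EuclideanSpace ℝ (Fin k)) :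
    euclideanLaplacian ψ x = ∑ i : Fin k,
      fderiv ℝ (fun y => fderiv ℝ ψ y (EuclideanSpace.single i 1)) x
        (EuclideanSpace.single i 1) := by
  refine Finset.sum_congr rfl fun i _ => ?_
  set e : EuclideanSpace ℝ (Fin k) := EuclideanSpace.single i 1
  have hline (t : ℝ) : HasDerivAt (fun t : ℝ => x + t • e) e t := by
    simpa using ((hasDerivAt_id t).smul_const e).const_add x
  have hd : Differentiable ℝ fun y => fderiv ℝ ψ y e :=
    ((hψ.fderiv_right (m := 1) (by norm_num)).clm_apply contDiff_const).differentiable one_ne_zero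
  have h1 : deriv (fun t : ℝ => ψ (x + t • e)) = fun t => fderiv ℝ ψ (x + t • e) e := by
    ext t
    exact ((hψ.differentiable two_ne_zero _).hasFDerivAt.comp_hasDerivAt t (hline t)).deriv
  rw [iteratedDeriv_succ, iteratedDeriv_one, h1]
  have := ((hd (x + (0 : ℝ) • e)).hasFDerivAt.comp_hasDerivAt 0 (hline 0)).deriv
  simpa [Function.comp_def] using this

theorem continuous_euclideanLaplacian {k : ℕ} {ψ : EuclideanSpace ℝ (Fin k) → ℝ}
    (hψ : ContDiff ℝ 2 ψ) : Continuous (euclideanLaplacian ψ) := by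
  rw [funext (euclideanLaplacian_eq_sum_fderiv hψ)]
  refine continuous_finsetSum _ fun i _ => ?_
  exact (((hψ.fderiv_right (m := 1) (by norm_num)).clm_apply contDiff_const).continuous_fderiv
    one_ne_zero).clm_apply continuous_const

theorem euclideanLaplacian_eq_zero_of_notMem_tsupport {k : ℕ}
    {ψ : EuclideanSpace ℝ (Fin k) → ℝ} (hψ : ContDiff ℝ 2 ψ) {x : EuclideanSpace ℝ (Fin k)}
    (hx : x ∉ tsupport ψ) : euclideanLaplacian ψ x = 0 := by
  rw [euclideanLaplacian_eq_sum_fderiv hψ]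
  refine Finset.sum_eq_zero fun i _ => ?_
  rw [fderiv_of_notMem_tsupport, zero_apply]
  exact fun h => hx (tsupport_fderiv_apply_subset ℝ _ h)

/-- The vector field whose divergence yields the weighted inequality. -/
noncomputable def rellichField {k : ℕ} (p c ε δ : ℝ) (ψ : EuclideanSpace ℝ (Fin k) → ℝ)
    (i : Fin k) (x : EuclideanSpace ℝ (Fin k)) : ℝ :=
  (ψ x + δ) ^ (p - 1) * (‖x‖ ^ 2 + ε) ^ (1 - p) * fderiv ℝ ψ x (EuclideanSpace.single i 1) +
    c * ((ψ x + δ) ^ p - δ ^ p) * (‖x‖ ^ 2 + ε) ^ (-p) * x i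

section Field

variable {k : ℕ} {p c ε δ : ℝ} {ψ : EuclideanSpace ℝ (Fin k) → ℝ}

theorem contDiff_rellichField (hψ : ContDiff ℝ 2 ψ) (hpos : ∀ x, 0 ≤ ψ x) (hε : 0 < ε)
    (hδ : 0 < δ) (i : Fin k) : ContDiff ℝ 1 (rellichField p c ε δ ψ i) := by
  have hψ1 : ContDiff ℝ 1 ψ := hψ.of_le (by norm_num)
  have hu (x) : ψ x + δ ≠ 0 := (add_pos_of_nonneg_of_pos (hpos x) hδ).ne'
  have hw (x : EuclideanSpace ℝ (Fin k)) : ‖x‖ ^ 2 + ε ≠ 0 := by positivity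
  have hud : ContDiff ℝ 1 fun x => ψ x + δ := hψ1.add contDiff_const
  have hwd : ContDiff ℝ 1 fun x : EuclideanSpace ℝ (Fin k) => ‖x‖ ^ 2 + ε :=
    (contDiff_norm_sq ℝ).add contDiff_const
  have hd : ContDiff ℝ 1 fun x => fderiv ℝ ψ x (EuclideanSpace.single i 1) :=
    (hψ.fderiv_right (m := 1) (by norm_num)).clm_apply contDiff_const
  have hx : ContDiff ℝ 1 fun x : EuclideanSpace ℝ (Fin k) => x i := by fun_prop
  unfold rellichField
  exact (((hud.rpow_const_of_ne hu).mul (hwd.rpow_const_of_ne hw)).mul hd).add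
    (((contDiff_const.mul ((hud.rpow_const_of_ne hu).sub contDiff_const)).mul
      (hwd.rpow_const_of_ne hw)).mul hx)

theorem tsupport_rellichField_subset (i : Fin k) :
    tsupport (rellichField p c ε δ ψ i) ⊆ tsupport ψ := by
  refine closure_minimal (fun x hx => ?_) (isClosed_tsupport ψ)
  by_contra h
  refine hx ?_
  simp [rellichField, fderiv_of_notMem_tsupport ℝ h, image_eq_zero_of_notMem_tsupport h]

theorem fderiv_rellichField (hψ : ContDiff ℝ 2 ψ) (hpos : ∀ x, 0 ≤ ψ x) (hε : 0 < ε)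
    (hδ : 0 < δ) (i : Fin k) (x : EuclideanSpace ℝ (Fin k)) :
    fderiv ℝ (rellichField p c ε δ ψ i) x (EuclideanSpace.single i 1) =
      (p - 1) * (ψ x + δ) ^ (p - 2) * (‖x‖ ^ 2 + ε) ^ (1 - p) *
          fderiv ℝ ψ x (EuclideanSpace.single i 1) ^ 2 +
        (ψ x + δ) ^ (p - 1) * (‖x‖ ^ 2 + ε) ^ (1 - p) *
          fderiv ℝ (fun y => fderiv ℝ ψ y (EuclideanSpace.single i 1)) x
            (EuclideanSpace.single i 1) +
        (c * p - 2 * (p - 1)) * (ψ x + δ) ^ (p - 1) * (‖x‖ ^ 2 + ε) ^ (-p) *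
          (x i * fderiv ℝ ψ x (EuclideanSpace.single i 1)) +
        c * ((ψ x + δ) ^ p - δ ^ p) *
          ((‖x‖ ^ 2 + ε) ^ (-p) - 2 * p * (‖x‖ ^ 2 + ε) ^ (-p - 1) * x i ^ 2) := by
  set e : EuclideanSpace ℝ (Fin k) := EuclideanSpace.single i 1 with he
  have hline : HasDerivAt (fun t : ℝ => x + t • e) e 0 := by
    simpa using ((hasDerivAt_id (0 : ℝ)).smul_const e).const_add x
  have along {f : EuclideanSpace ℝ (Fin k) → ℝ} (hf : DifferentiableAt ℝ f x) :
      HasDerivAt (fun t : ℝ => f (x + t • e)) (fderiv ℝ f x e) 0 := by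
    have h0 : x = x + (0 : ℝ) • e := by simp
    have hf' : HasFDerivAt f (fderiv ℝ f x) (x + (0 : ℝ) • e) := by
      rw [← h0]; exact hf.hasFDerivAt
    exact hf'.comp_hasDerivAt 0 hline
  have hu : ψ x + δ ≠ 0 := (add_pos_of_nonneg_of_pos (hpos x) hδ).ne'
  have hw : ‖x‖ ^ 2 + ε ≠ 0 := by positivity
  have hψx := (along (hψ.differentiable two_ne_zero x)).add_const δ
  have hd := along (((hψ.fderiv_right (m := 1) (by norm_num)).clm_apply
    (contDiff_const (c := e))).differentiable one_ne_zero x)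
  have hwx : HasDerivAt (fun t : ℝ => ‖x + t • e‖ ^ 2 + ε) (2 * x i) 0 := by
    have := hline.norm_sq.add_const ε
    simpa [he, EuclideanSpace.inner_single_right] using this
  have hxi : HasDerivAt (fun t : ℝ => (x + t • e) i) 1 0 := by
    have := ((hasDerivAt_id (0 : ℝ)).add_const (x i))
    simpa [he, add_comm] using this
  have hF := along ((contDiff_rellichField (p := p) (c := c) hψ hpos hε hδ i).differentiable
    one_ne_zero x)
  have hG := (((hψx.rpow_const (p := p - 1) (by left; simpa using hu)).mul
    (hwx.rpow_const (p := 1 - p) (by left; simpa using hw))).mul hd).add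
    ((((hψx.rpow_const (p := p) (by left; simpa using hu)).sub_const (δ ^ p)).const_mul c |>.mul
      (hwx.rpow_const (p := -p) (by left; simpa using hw))).mul hxi)
  refine (hF.unique hG).trans ?_
  simp only [zero_smul, add_zero, Pi.mul_apply]
  rw [show p - 1 - 1 = p - 2 by ring, show 1 - p - 1 = -p by ring]
  ring

end Field

/-- Pointwise lower bound for a divergence, by completing the square. -/
theorem rellich_pointwise_bound {p k c u d w q a L S T R : ℝ} (hp : 1 < p) (hc : 0 ≤ c)
    (hu : 0 < u) (hw : 0 < w) (hq : 0 < q) (ha : 0 < a) (hd : d ≤ u * a) (hS : 0 ≤ S)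
    (hRw : R ≤ w) (hT : T ^ 2 ≤ R * S) :
    c * (k - 2 * p) * (u * a - d) * q -
          (c * p - 2 * (p - 1)) ^ 2 / (4 * (p - 1)) * (u * a) * q - |L| * (a * (w * q)) ≤
      (p - 1) * (a / u) * (w * q) * S + a * (w * q) * L + (c * p - 2 * (p - 1)) * a * q * T +
        c * (u * a - d) * (k * q - 2 * p * (q / w) * R) := by
  have hp' : 0 < p - 1 := by linarith
  set B := c * p - 2 * (p - 1)
  have hL : -(|L| * (a * (w * q))) ≤ a * (w * q) * L := by
    nlinarith [neg_abs_le L, mul_pos ha (mul_pos hw hq)]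
  have hR : q / w * R ≤ q := by
    rw [div_mul_eq_mul_div, div_le_iff₀ hw]
    exact mul_le_mul_of_nonneg_left hRw hq.le
  have hcd : 0 ≤ c * (u * a - d) := mul_nonneg hc (by linarith)
  have h1 : c * (u * a - d) * ((k - 2 * p) * q) ≤
      c * (u * a - d) * (k * q - 2 * p * (q / w) * R) :=
    mul_le_mul_of_nonneg_left (by nlinarith) hcd
  have hTS : T ^ 2 ≤ w * S := hT.trans (mul_le_mul_of_nonneg_right hRw hS)
  have h2 : 0 ≤ (p - 1) * (a / u) * (w * q) * S + B * a * q * T +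
      B ^ 2 / (4 * (p - 1)) * (u * a) * q := by
    have hsq : 0 ≤ (p - 1) * (a / u) * q * (T + B * u / (2 * (p - 1))) ^ 2 := by positivity
    have hle : (p - 1) * (a / u) * q * T ^ 2 ≤ (p - 1) * (a / u) * q * (w * S) :=
      mul_le_mul_of_nonneg_left hTS (by positivity)
    have hexp : (p - 1) * (a / u) * q * (T + B * u / (2 * (p - 1))) ^ 2 =
        (p - 1) * (a / u) * q * T ^ 2 + B * a * q * T +
          B ^ 2 / (4 * (p - 1)) * (u * a) * q := by
      field_simp
      ring
    linarith
  linarith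

section Weighted

variable {k : ℕ} {p c ε δ : ℝ} {ψ : EuclideanSpace ℝ (Fin k) → ℝ}

theorem le_sum_fderiv_rellichField (hp : 1 < p) (hc : 0 ≤ c) (hψ : ContDiff ℝ 2 ψ)
    (hpos : ∀ x, 0 ≤ ψ x) (hε : 0 < ε) (hδ : 0 < δ) (x : EuclideanSpace ℝ (Fin k)) :
    c * (k - 2 * p) * ((ψ x + δ) ^ p - δ ^ p) * (‖x‖ ^ 2 + ε) ^ (-p) -
          (c * p - 2 * (p - 1)) ^ 2 / (4 * (p - 1)) * (ψ x + δ) ^ p * (‖x‖ ^ 2 + ε) ^ (-p) -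
        |euclideanLaplacian ψ x| * ((ψ x + δ) ^ (p - 1) * (‖x‖ ^ 2 + ε) ^ (1 - p)) ≤
      ∑ i, fderiv ℝ (rellichField p c ε δ ψ i) x (EuclideanSpace.single i 1) := by
  have hu : 0 < ψ x + δ := add_pos_of_nonneg_of_pos (hpos x) hδ
  have hw : 0 < ‖x‖ ^ 2 + ε := by positivity
  have hR : ∑ i, x i ^ 2 = ‖x‖ ^ 2 := (EuclideanSpace.real_norm_sq_eq x).symm
  have hup : (ψ x + δ) ^ p = (ψ x + δ) * (ψ x + δ) ^ (p - 1) := by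
    rw [rpow_sub_one hu.ne']; field_simp
  have hup2 : (ψ x + δ) ^ (p - 2) = (ψ x + δ) ^ (p - 1) / (ψ x + δ) := by
    rw [← rpow_sub_one hu.ne']; ring_nf
  have hw1 : (‖x‖ ^ 2 + ε) ^ (1 - p) = (‖x‖ ^ 2 + ε) * (‖x‖ ^ 2 + ε) ^ (-p) := by
    rw [sub_eq_add_neg, rpow_add hw, rpow_one]
  have hw2 : (‖x‖ ^ 2 + ε) ^ (-p - 1) = (‖x‖ ^ 2 + ε) ^ (-p) / (‖x‖ ^ 2 + ε) :=
    rpow_sub_one hw.ne' _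
  have hd : δ ^ p ≤ (ψ x + δ) * (ψ x + δ) ^ (p - 1) := by
    rw [← hup]
    exact rpow_le_rpow hδ.le (by linarith [hpos x]) (by linarith)
  have key := rellich_pointwise_bound (k := k) (L := euclideanLaplacian ψ x)
    (S := ∑ i, fderiv ℝ ψ x (EuclideanSpace.single i 1) ^ 2)
    (T := ∑ i, x i * fderiv ℝ ψ x (EuclideanSpace.single i 1)) (R := ‖x‖ ^ 2)
    hp hc hu hw (rpow_pos_of_pos hw (-p)) (rpow_pos_of_pos hu (p - 1)) hd
    (Finset.sum_nonneg fun _ _ => sq_nonneg _) (by linarith)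
    (by rw [← hR]; exact Finset.sum_mul_sq_le_sq_mul_sq _ _ _)
  rw [← hup, ← hup2, ← hw1, ← hw2] at key
  refine key.trans_eq ?_
  simp only [fderiv_rellichField hψ hpos hε hδ, Finset.sum_add_distrib, ← Finset.mul_sum,
    Finset.sum_sub_distrib, hR, ← euclideanLaplacian_eq_sum_fderiv hψ]
  simp

theorem integral_sum_fderiv_rellichField (hψ : ContDiff ℝ 2 ψ) (hsupp : HasCompactSupport ψ)
    (hpos : ∀ x, 0 ≤ ψ x) (hε : 0 < ε) (hδ : 0 < δ) :
    ∫ x in tsupport ψ, ∑ i, fderiv ℝ (rellichField p c ε δ ψ i) x (EuclideanSpace.single i 1)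
      = 0 := by
  have hs (i : Fin k) : HasCompactSupport (rellichField p c ε δ ψ i) :=
    hsupp.of_isClosed_subset (isClosed_tsupport _) (tsupport_rellichField_subset i)
  have hd (i : Fin k) := contDiff_rellichField (p := p) (c := c) hψ hpos hε hδ i
  rw [setIntegral_eq_integral_of_forall_compl_eq_zero, integral_finsetSum]
  · exact Finset.sum_eq_zero fun i _ => integral_fderiv_apply_eq_zero volume (hd i) (hs i) _
  · intro i _
    exact (((hd i).continuous_fderiv one_ne_zero).clm_apply
      continuous_const).integrable_of_hasCompactSupport ((hs i).fderiv_apply ℝ _)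
  · intro x hx
    refine Finset.sum_eq_zero fun i _ => ?_
    rw [fderiv_of_notMem_tsupport ℝ fun h => hx (tsupport_rellichField_subset i h), zero_apply]

/-- The weighted inequality for `ψ`, obtained from that for `ψ + δ` by letting `δ` tend to zero. -/
theorem setIntegral_rellich_weighted_nonpos (hp : 1 < p) (hc : 0 ≤ c) (hψ : ContDiff ℝ 2 ψ)
    (hsupp : HasCompactSupport ψ) (hpos : ∀ x, 0 ≤ ψ x) (hε : 0 < ε) :
    ∫ x in tsupport ψ, (c * (k - 2 * p) * (ψ x ^ p) * (‖x‖ ^ 2 + ε) ^ (-p) -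
          (c * p - 2 * (p - 1)) ^ 2 / (4 * (p - 1)) * ψ x ^ p * (‖x‖ ^ 2 + ε) ^ (-p) -
        |euclideanLaplacian ψ x| * (ψ x ^ (p - 1) * (‖x‖ ^ 2 + ε) ^ (1 - p))) ≤ 0 := by
  let G (δ : ℝ) (x : EuclideanSpace ℝ (Fin k)) : ℝ :=
    c * (k - 2 * p) * ((ψ x + δ) ^ p - δ ^ p) * (‖x‖ ^ 2 + ε) ^ (-p) -
          (c * p - 2 * (p - 1)) ^ 2 / (4 * (p - 1)) * (ψ x + δ) ^ p * (‖x‖ ^ 2 + ε) ^ (-p) -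
        |euclideanLaplacian ψ x| * ((ψ x + δ) ^ (p - 1) * (‖x‖ ^ 2 + ε) ^ (1 - p))
  have hL := continuous_euclideanLaplacian hψ
  have hψc := hψ.continuous
  have hG : Continuous G.uncurry := by
    have hw (s : ℝ) : Continuous fun z : ℝ × EuclideanSpace ℝ (Fin k) => (‖z.2‖ ^ 2 + ε) ^ s :=
      Continuous.rpow_const (by fun_prop) fun z => Or.inl (by positivity)
    have hu {s : ℝ} (hs : 0 ≤ s) :
        Continuous fun z : ℝ × EuclideanSpace ℝ (Fin k) => (ψ z.2 + z.1) ^ s :=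
      Continuous.rpow_const (by fun_prop) fun z => Or.inr hs
    have hδ : Continuous fun z : ℝ × EuclideanSpace ℝ (Fin k) => z.1 ^ p :=
      Continuous.rpow_const (by fun_prop) fun z => Or.inr (by linarith)
    have hp0 : 0 ≤ p := by linarith
    exact (((continuous_const.mul ((hu hp0).sub hδ)).mul (hw _)).sub
      ((continuous_const.mul (hu hp0)).mul (hw _))).sub
      ((hL.comp continuous_snd).abs.mul ((hu (by linarith)).mul (hw _)))
  have hGint : Continuous fun δ => ∫ x in tsupport ψ, G δ x :=
    continuous_parametric_integral_of_continuous hG hsupp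
  have hneg : ∀ δ > 0, ∫ x in tsupport ψ, G δ x ≤ 0 := by
    intro δ hδ
    rw [← integral_sum_fderiv_rellichField (p := p) (c := c) hψ hsupp hpos hε hδ]
    refine setIntegral_mono_on ?_ ?_ (isClosed_tsupport ψ).measurableSet
      fun x _ => le_sum_fderiv_rellichField hp hc hψ hpos hε hδ x
    · exact (hG.comp (Continuous.prodMk_right δ)).continuousOn.integrableOn_compact hsupp
    · refine Continuous.continuousOn ?_ |>.integrableOn_compact hsupp
      exact continuous_finsetSum _ fun i _ =>
        ((contDiff_rellichField hψ hpos hε hδ i).continuous_fderiv one_ne_zero).clm_apply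
          continuous_const
  have h0 : ∫ x in tsupport ψ, G 0 x ≤ 0 :=
    le_of_tendsto (hGint.continuousAt.tendsto.mono_left (nhdsWithin_le_nhds (s := Set.Ioi 0)))
      (Filter.eventually_of_mem self_mem_nhdsWithin hneg)
  simpa only [G, add_zero, zero_rpow (by linarith : p ≠ 0), sub_zero] using h0

theorem rellich_regularized (hp : 1 < p) (hk : 2 * p < k) (hψ : ContDiff ℝ 2 ψ)
    (hsupp : HasCompactSupport ψ) (hpos : ∀ x, 0 ≤ ψ x) (hε : 0 < ε) :
    (k * (k - 2 * p) * (p - 1) / p ^ 2) ^ p * ∫ x, ψ x ^ p * (‖x‖ ^ 2 + ε) ^ (-p) ≤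
      ∫ x, |euclideanLaplacian ψ x| ^ p := by
  have hp0 : 0 < p := by linarith
  have hp1 : 0 < p - 1 := by linarith
  have hk2 : 0 < (k : ℝ) - 2 * p := by linarith
  set C : ℝ := k * (k - 2 * p) * (p - 1) / p ^ 2 with hC
  have hC0 : 0 < C := by
    have : (0 : ℝ) < k := by linarith
    positivity
  have hL := continuous_euclideanLaplacian hψ
  have hψc := hψ.continuous
  have hw (x : EuclideanSpace ℝ (Fin k)) : 0 < ‖x‖ ^ 2 + ε := by positivity
  have hwc (s : ℝ) : Continuous fun x : EuclideanSpace ℝ (Fin k) => (‖x‖ ^ 2 + ε) ^ s :=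
    Continuous.rpow_const (by fun_prop) fun x => Or.inl (hw x).ne'
  have hψp {s : ℝ} (hs : 0 ≤ s) : Continuous fun x => ψ x ^ s :=
    hψc.rpow_const fun _ => Or.inr hs
  have hLp : Continuous fun x => |euclideanLaplacian ψ x| ^ p :=
    hL.abs.rpow_const fun _ => Or.inr hp0.le
  set c : ℝ := (2 * (p - 1) * (k - 2 * p) / p + 2 * (p - 1)) / p with hc
  have hcC : c * (k - 2 * p) - (c * p - 2 * (p - 1)) ^ 2 / (4 * (p - 1)) = C := by
    rw [hc, hC]; field_simp; ring
  have key := setIntegral_rellich_weighted_nonpos (c := c) hp (by positivity) hψ hsupp hpos hε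
  have young (x) : C ^ (p - 1) *
      (|euclideanLaplacian ψ x| * (ψ x ^ (p - 1) * (‖x‖ ^ 2 + ε) ^ (1 - p))) ≤
      |euclideanLaplacian ψ x| ^ p / p +
        (1 - 1 / p) * (C ^ p * (ψ x ^ p * (‖x‖ ^ 2 + ε) ^ (-p))) := by
    have hconj : p.HolderConjugate (p / (p - 1)) := Real.HolderConjugate.conjExponent hp
    have hb : 0 ≤ C * (ψ x / (‖x‖ ^ 2 + ε)) :=
      mul_nonneg hC0.le (div_nonneg (hpos x) (hw x).le)
    have hmul (s : ℝ) : (C * (ψ x / (‖x‖ ^ 2 + ε))) ^ s =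
        C ^ s * (ψ x ^ s * (‖x‖ ^ 2 + ε) ^ (-s)) := by
      rw [mul_rpow hC0.le (div_nonneg (hpos x) (hw x).le), div_rpow (hpos x) (hw x).le,
        rpow_neg (hw x).le, div_eq_mul_inv]
    have h := young_inequality_of_nonneg (abs_nonneg (euclideanLaplacian ψ x))
      (rpow_nonneg hb (p - 1)) hconj
    rw [← rpow_mul hb, mul_div_cancel₀ _ hp1.ne', hmul, hmul, neg_sub] at h
    refine (le_of_eq (by ring)).trans (h.trans (le_of_eq ?_))
    field_simp
  have hK := isClosed_tsupport ψ |>.measurableSet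
  have hI1 : IntegrableOn (fun x => |euclideanLaplacian ψ x| ^ p) (tsupport ψ) :=
    hLp.continuousOn.integrableOn_compact hsupp
  have hI2 : IntegrableOn (fun x => ψ x ^ p * (‖x‖ ^ 2 + ε) ^ (-p)) (tsupport ψ) :=
    ((hψp hp0.le).mul (hwc _)).continuousOn.integrableOn_compact hsupp
  have hCp : C ^ p = C ^ (p - 1) * C := by rw [rpow_sub_one hC0.ne']; field_simp
  have hmono : ∫ x in tsupport ψ, (C ^ p / p * (ψ x ^ p * (‖x‖ ^ 2 + ε) ^ (-p)) -
      1 / p * |euclideanLaplacian ψ x| ^ p) ≤ C ^ (p - 1) * 0 := by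
    refine le_trans ?_ (mul_le_mul_of_nonneg_left key (rpow_nonneg hC0.le _))
    rw [← integral_const_mul]
    refine setIntegral_mono_on ((hI2.const_mul _).sub (hI1.const_mul _)) ?_ hK fun x _ => ?_
    · refine Continuous.continuousOn ?_ |>.integrableOn_compact hsupp
      exact continuous_const.mul ((((continuous_const.mul (hψp hp0.le)).mul (hwc _)).sub
        ((continuous_const.mul (hψp hp0.le)).mul (hwc _))).sub
        (hL.abs.mul ((hψp hp1.le).mul (hwc _))))
    · have hy := young x
      rw [← sub_mul, ← sub_mul, hcC]
      linear_combination hy + (ψ x ^ p * (‖x‖ ^ 2 + ε) ^ (-p)) * hCp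
  rw [integral_sub (hI2.const_mul _) (hI1.const_mul _), integral_const_mul, integral_const_mul,
    setIntegral_eq_integral_of_forall_compl_eq_zero,
    setIntegral_eq_integral_of_forall_compl_eq_zero] at hmono
  · have := mul_le_mul_of_nonneg_left hmono hp0.le
    field_simp at this
    linarith
  · intro x hx
    rw [euclideanLaplacian_eq_zero_of_notMem_tsupport hψ hx, abs_zero, zero_rpow hp0.ne']
  · intro x hx
    rw [image_eq_zero_of_notMem_tsupport hx, zero_rpow hp0.ne', zero_mul]

end Weighted

/-- Flat case of the Rellich corollary with `γ = 2p` (Corollary `cor_rellich` of the paper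
with `M = ℝᵏ`, so `Φ = 0` and there is no boundary term):
`(k^p (k−2p)^p (p−1)^p / p^{2p}) ∫ ψ^p ‖x‖^{−2p} ≤ ∫ |Δψ|^p`. -/
theorem rellich_flat_gamma_two_p (k : ℕ) (p : ℝ) (hp : 1 < p) (hk : 2 * p < (k : ℝ))
    (ψ : EuclideanSpace ℝ (Fin k) → ℝ) (hψ : ContDiff ℝ 2 ψ)
    (hsupp : HasCompactSupport ψ) (hpos : ∀ x, 0 ≤ ψ x) :
    (k : ℝ) ^ p * ((k : ℝ) - 2 * p) ^ p * (p - 1) ^ p / p ^ (2 * p) *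
        ∫ x : EuclideanSpace ℝ (Fin k), ψ x ^ p * ‖x‖ ^ (-(2 * p))
      ≤ ∫ x : EuclideanSpace ℝ (Fin k), |euclideanLaplacian ψ x| ^ p := by
  have hp0 : 0 < p := by linarith
  have hp1 : 0 ≤ p - 1 := by linarith
  have hk0 : (0 : ℝ) < k := by linarith
  have hk2 : 0 ≤ (k : ℝ) - 2 * p := by linarith
  have hconst : (k : ℝ) ^ p * ((k : ℝ) - 2 * p) ^ p * (p - 1) ^ p / p ^ (2 * p) =
      (k * (k - 2 * p) * (p - 1) / p ^ 2) ^ p := by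
    rw [div_rpow (by positivity) (by positivity), mul_rpow (by positivity) hp1,
      mul_rpow hk0.le hk2, rpow_mul hp0.le, rpow_two]
  rw [hconst]
  by_cases hint : Integrable fun x : EuclideanSpace ℝ (Fin k) => ψ x ^ p * ‖x‖ ^ (-(2 * p))
  swap
  · rw [integral_undef hint, mul_zero]
    exact integral_nonneg fun x => rpow_nonneg (abs_nonneg _) _
  have : Nontrivial (EuclideanSpace ℝ (Fin k)) := by
    have : Nonempty (Fin k) := Fin.pos_iff_nonempty.mp (by exact_mod_cast hk0)
    infer_instance
  have hne : ∀ᵐ x : EuclideanSpace ℝ (Fin k), x ≠ 0 := Measure.ae_ne volume 0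
  have hsq (x : EuclideanSpace ℝ (Fin k)) : ‖x‖ ^ (-(2 * p)) = (‖x‖ ^ 2) ^ (-p) := by
    rw [← rpow_two, ← rpow_mul (norm_nonneg x), mul_neg]
  have hlim : Filter.Tendsto
      (fun n : ℕ => ∫ x : EuclideanSpace ℝ (Fin k),
        ψ x ^ p * (‖x‖ ^ 2 + 1 / ((n : ℝ) + 1)) ^ (-p)) Filter.atTop
      (nhds (∫ x : EuclideanSpace ℝ (Fin k), ψ x ^ p * ‖x‖ ^ (-(2 * p)))) := by
    refine tendsto_integral_of_dominated_convergence _ (fun n => ?_) hint (fun n => ?_) ?_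
    · have hψc := hψ.continuous
      refine Continuous.aestronglyMeasurable ?_
      exact (hψc.rpow_const fun _ => Or.inr hp0.le).mul
        (Continuous.rpow_const (by fun_prop) fun x => Or.inl (by positivity))
    · filter_upwards [hne] with x hx
      have hx2 : 0 < ‖x‖ ^ 2 := by positivity
      rw [norm_of_nonneg (mul_nonneg (rpow_nonneg (hpos x) _) (by positivity)), hsq]
      refine mul_le_mul_of_nonneg_left ?_ (rpow_nonneg (hpos x) _)
      exact rpow_le_rpow_of_nonpos hx2 (le_add_of_nonneg_right (by positivity)) (by linarith)
    · filter_upwards [hne] with x hx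
      have hx2 : ‖x‖ ^ 2 ≠ 0 := by positivity
      rw [hsq]
      refine Filter.Tendsto.const_mul _ (Filter.Tendsto.rpow_const ?_ (Or.inl hx2))
      simpa using (tendsto_one_div_add_atTop_nhds_zero_nat (𝕜 := ℝ)).const_add (‖x‖ ^ 2)
  exact le_of_tendsto (hlim.const_mul _) (Filter.Eventually.of_forall fun n =>
    rellich_regularized hp hk hψ hsupp hpos (by positivity))
end
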